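/- If, for L > 0, H ∈ ℝ^{d×d} is an L-contracting matrix in the sense that sup{Re(λ) : λ eigenvalue of H} < −L, then there exist a norm ‖·‖ on ℝ^d induced by an inner product and ε₀ > 0 such that for all ε ∈ [0, ε₀] the induced operator norm satisfies ‖I + εH‖ ≤ 1 − εL. -/

import Mathlib

open Matrix

lemma aux_eps (L : ℝ) (S : Set ℂ) (hS : S.Finite) (h : ∀ z ∈ S, z.re < -L) :
    ∃ e : ℝ, 0 < e ∧ 0 < 1 - e * L ∧ ∀ z ∈ S, ‖1 + (e : ℂ) * z‖ < 1 - e * L := by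
  have h1 : ∀ᶠ e : ℝ in nhdsWithin 0 (Set.Ioi 0), 0 < 1 - e * L := by
    apply Filter.Eventually.filter_mono nhdsWithin_le_nhds
    have : ContinuousAt (fun e : ℝ => 1 - e * L) 0 := by fun_prop
    exact this.eventually (lt_mem_nhds (by simp))
  have h2 : ∀ᶠ e : ℝ in nhdsWithin 0 (Set.Ioi 0), ∀ z ∈ S,
      2 * (z.re + L) + e * (z.re ^ 2 + z.im ^ 2 - L ^ 2) < 0 := by
    rw [Filter.eventually_all_finite hS]
    intro z hz
    apply Filter.Eventually.filter_mono nhdsWithin_le_nhds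
    have : ContinuousAt
      (fun e : ℝ => 2 * (z.re + L) + e * (z.re ^ 2 + z.im ^ 2 - L ^ 2)) 0 := by fun_prop
    exact this.eventually (gt_mem_nhds (by have := h z hz; simp; linarith))
  obtain ⟨e, ⟨h1, h2⟩, h3⟩ := ((h1.and h2).and self_mem_nhdsWithin).exists
  have h3 : 0 < e := h3
  refine ⟨e, h3, h1, fun z hz => ?_⟩
  apply lt_of_pow_lt_pow_left₀ 2 h1.le
  rw [Complex.sq_norm, Complex.normSq_apply]
  have := mul_neg_of_pos_of_neg h3 (h2 z hz)
  simp
  nlinarith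

lemma aux_spec {d : ℕ} (A : Matrix (Fin d) (Fin d) ℂ) (e : ℝ) (he : 0 < e) (w : ℂ)
    (hw : w ∈ spectrum ℂ (1 + (e : ℂ) • A)) : ∃ z ∈ spectrum ℂ A, w = 1 + e * z := by
  have he' : (e : ℂ) ≠ 0 := by exact_mod_cast he.ne'
  refine ⟨(w - 1) / e, ?_, by field_simp; ring⟩
  rw [← spectrum.smul_mem_smul_iff (r := Units.mk0 (e : ℂ) he'),
    ← spectrum.add_mem_add_iff (s := 1)]
  convert hw using 1
  · simp [Units.smul_def]
  · simp only [Units.smul_def, Units.val_mk0, smul_eq_mul]; field_simp; ring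

open scoped Matrix.Norms.L2Operator in
lemma aux_pow {d : ℕ} [NeZero d] (A : Matrix (Fin d) (Fin d) ℝ) (r : ℝ) (hr : 0 < r)
    (h : ∀ z ∈ spectrum ℂ (A.map (algebraMap ℝ ℂ)), ‖z‖ < r) :
    ∃ N : ℕ, 0 < N ∧ ∀ x : Fin d → ℝ,
      ((A ^ N) *ᵥ x) ⬝ᵥ ((A ^ N) *ᵥ x) ≤ (r ^ N) ^ 2 * (x ⬝ᵥ x) := by
  set B := A.map (algebraMap ℝ ℂ) with hB
  lift r to NNReal using hr.le
  have h1 : spectralRadius ℂ B < r :=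
    spectrum.spectralRadius_lt_of_forall_lt B (fun z hz => h z hz)
  have h2 := (spectrum.pow_nnnorm_pow_one_div_tendsto_nhds_spectralRadius B).eventually
    (gt_mem_nhds h1)
  obtain ⟨N, hN, hN0⟩ := (h2.and (Filter.eventually_gt_atTop 0)).exists
  refine ⟨N, hN0, fun x => ?_⟩
  have hN1 : (N : ℝ) ≠ 0 := by exact_mod_cast hN0.ne'
  have h3 : ‖B ^ N‖ ≤ (r : ℝ) ^ N := by
    have := ENNReal.rpow_le_rpow hN.le (Nat.cast_nonneg N : (0 : ℝ) ≤ N)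
    rw [← ENNReal.rpow_mul, one_div_mul_cancel hN1, ENNReal.rpow_one, ENNReal.rpow_natCast] at this
    exact_mod_cast this
  have h4 := Matrix.l2_opNorm_mulVec (B ^ N) (WithLp.toLp 2 (fun i => (x i : ℂ)))
  have h5 := h4.trans (mul_le_mul_of_nonneg_right h3 (norm_nonneg _))
  have h6 := pow_le_pow_left₀ (norm_nonneg _) h5 2
  rw [mul_pow, EuclideanSpace.norm_sq_eq, EuclideanSpace.norm_sq_eq] at h6
  have h7 : B ^ N = (A ^ N).map (algebraMap ℝ ℂ) := by
    rw [hB]; exact (map_pow (algebraMap ℝ ℂ).mapMatrix A N).symm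
  have h8 : ∀ i, ((B ^ N) *ᵥ (fun i => (x i : ℂ))) i = (((A ^ N) *ᵥ x) i : ℝ) := by
    intro i
    rw [h7]
    simp [mulVec, dotProduct]
  simpa [h8, dotProduct, ← pow_two] using h6

lemma aux_P {d : ℕ} (A : Matrix (Fin d) (Fin d) ℝ) (r : ℝ) (hr : 0 < r) (N : ℕ) (hN : 0 < N)
    (h : ∀ x : Fin d → ℝ,
      ((A ^ N) *ᵥ x) ⬝ᵥ ((A ^ N) *ᵥ x) ≤ (r ^ N) ^ 2 * (x ⬝ᵥ x)) :
    ∃ P : Matrix (Fin d) (Fin d) ℝ, P.PosDef ∧ ∀ x : Fin d → ℝ,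
      (A *ᵥ x) ⬝ᵥ (P *ᵥ (A *ᵥ x)) ≤ r ^ 2 * (x ⬝ᵥ (P *ᵥ x)) := by
  set P : Matrix (Fin d) (Fin d) ℝ :=
    ∑ k ∈ Finset.range N, ((r ^ k) ^ 2)⁻¹ • ((A ^ k)ᵀ * A ^ k) with hP
  have hq : ∀ x : Fin d → ℝ, x ⬝ᵥ (P *ᵥ x) =
      ∑ k ∈ Finset.range N, ((r ^ k) ^ 2)⁻¹ * (((A ^ k) *ᵥ x) ⬝ᵥ ((A ^ k) *ᵥ x)) := by
    intro x
    rw [hP, Matrix.sum_mulVec, dotProduct_sum]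
    refine Finset.sum_congr rfl fun k _ => ?_
    rw [smul_mulVec, dotProduct_smul, ← mulVec_mulVec, dotProduct_mulVec, vecMul_transpose,
      smul_eq_mul]
  have hnn : ∀ y : Fin d → ℝ, 0 ≤ y ⬝ᵥ y := fun y =>
    Finset.sum_nonneg fun i _ => mul_self_nonneg _
  refine ⟨P, Matrix.PosDef.of_dotProduct_mulVec_pos ?_ ?_, ?_⟩
  · rw [Matrix.IsHermitian, hP, conjTranspose_sum]
    refine Finset.sum_congr rfl fun k _ => ?_
    simp [conjTranspose_eq_transpose_of_trivial]
  · intro x hx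
    rw [star_trivial, hq]
    apply Finset.sum_pos' (fun k _ => mul_nonneg (by positivity) (hnn _))
    refine ⟨0, Finset.mem_range.2 hN, ?_⟩
    have : x ⬝ᵥ x ≠ 0 := fun h0 => hx (dotProduct_self_eq_zero.1 h0)
    simpa using lt_of_le_of_ne (hnn x) this.symm
  · intro x
    rw [hq, hq]
    set f : ℕ → ℝ := fun k => ((r ^ k) ^ 2)⁻¹ * (((A ^ k) *ᵥ x) ⬝ᵥ ((A ^ k) *ᵥ x)) with hf
    have e1 : ∀ k, ((r ^ k) ^ 2)⁻¹ * (((A ^ k) *ᵥ (A *ᵥ x)) ⬝ᵥ ((A ^ k) *ᵥ (A *ᵥ x)))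
        = r ^ 2 * f (k + 1) := by
      intro k
      simp only [hf, mulVec_mulVec, ← pow_succ]
      field_simp
      ring
    simp only [e1]
    rw [← Finset.mul_sum]
    apply mul_le_mul_of_nonneg_left _ (by positivity)
    have e2 := Finset.sum_range_succ f N
    rw [Finset.sum_range_succ'] at e2
    have e3 : f N ≤ f 0 := by
      simp only [hf, pow_zero, one_mulVec, one_pow, inv_one, one_mul]
      rw [inv_mul_le_iff₀ (by positivity)]
      exact h x
    change _ ≤ ∑ k ∈ Finset.range N, f k
    linarith


/-- If `H` is `L`-contracting in the sense that all eigenvalues of `H` have real part `< −L`,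
then there is a norm on `ℝ^d` induced by an inner product (given by a positive definite matrix
`P`, with `‖x‖_P = √(xᵀ P x)`) and `ε₀ > 0` such that for all `ε ∈ [0, ε₀]` the induced operator
norm of `I + εH` is at most `1 − εL`; equivalently, `‖(I + εH)x‖_P ≤ (1 − εL)‖x‖_P` for all
`x ∈ ℝ^d`. -/
theorem exists_inner_product_norm_contraction {d : ℕ} (L : ℝ) (hL : 0 < L)
    (H : Matrix (Fin d) (Fin d) ℝ)
    (hHev : ∀ z ∈ spectrum ℂ (H.map (algebraMap ℝ ℂ)), z.re < -L) :
    ∃ P : Matrix (Fin d) (Fin d) ℝ, P.PosDef ∧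
      ∃ ε₀ > (0 : ℝ), ∀ ε ∈ Set.Icc (0 : ℝ) ε₀, ∀ x : Fin d → ℝ,
        Real.sqrt (((1 + ε • H) *ᵥ x) ⬝ᵥ (P *ᵥ ((1 + ε • H) *ᵥ x)))
          ≤ (1 - ε * L) * Real.sqrt (x ⬝ᵥ (P *ᵥ x)) := by
  rcases Nat.eq_zero_or_pos d with rfl | hd
  · refine ⟨1, Matrix.PosDef.one, 1, one_pos, fun ε _ x => ?_⟩
    simp [dotProduct]
  haveI : NeZero d := ⟨hd.ne'⟩
  obtain ⟨e, he, hr, hspec⟩ := aux_eps L _ (Matrix.finite_spectrum _) hHev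
  set r := 1 - e * L with hrdef
  have hmap : (1 + e • H).map (algebraMap ℝ ℂ) = 1 + (e : ℂ) • H.map (algebraMap ℝ ℂ) := by
    ext i j
    by_cases hij : i = j <;> simp [Matrix.one_apply, hij]
  obtain ⟨N, hN, hpow⟩ := aux_pow (1 + e • H) r hr (by
    intro w hw
    rw [hmap] at hw
    obtain ⟨z, hz, rfl⟩ := aux_spec _ e he w hw
    exact hspec z hz)
  obtain ⟨P, hP, hPc⟩ := aux_P (1 + e • H) r hr N hN hpow
  refine ⟨P, hP, e, he, fun ε hε x => ?_⟩
  obtain ⟨hε0, hε1⟩ := hε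
  set y := (1 + e • H) *ᵥ x with hy
  have hnn : ∀ v : Fin d → ℝ, 0 ≤ v ⬝ᵥ (P *ᵥ v) := fun v => by
    simpa using hP.posSemidef.dotProduct_mulVec_nonneg v
  have hsymm : y ⬝ᵥ (P *ᵥ x) = x ⬝ᵥ (P *ᵥ y) := by
    have hT : Pᵀ = P := by
      simpa [conjTranspose_eq_transpose_of_trivial] using hP.isHermitian.eq
    rw [dotProduct_mulVec, ← mulVec_transpose, hT, dotProduct_comm]
  have hyx : y ⬝ᵥ (P *ᵥ y) ≤ r ^ 2 * (x ⬝ᵥ (P *ᵥ x)) := hPc x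
  have hcs : x ⬝ᵥ (P *ᵥ y) ≤ r * (x ⬝ᵥ (P *ᵥ x)) := by
    have h := hnn (r • x - y)
    simp only [mulVec_sub, mulVec_smul, sub_dotProduct, dotProduct_sub, smul_dotProduct,
      dotProduct_smul, smul_eq_mul, hsymm] at h
    have : r * (x ⬝ᵥ (P *ᵥ y)) ≤ r * (r * (x ⬝ᵥ (P *ᵥ x))) := by nlinarith
    exact le_of_mul_le_mul_left this hr
  obtain ⟨t, ht0, ht1, rfl⟩ : ∃ t : ℝ, 0 ≤ t ∧ t ≤ 1 ∧ ε = t * e :=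
    ⟨ε / e, by positivity, (div_le_one he).2 hε1, by field_simp⟩
  have hv : (1 + (t * e) • H) *ᵥ x = (1 - t) • x + t • y := by
    rw [hy]
    simp only [add_mulVec, one_mulVec, smul_mulVec, smul_add, smul_smul]
    module
  have hc : 1 - t * e * L = (1 - t) + t * r := by rw [hrdef]; ring
  have hc0 : 0 ≤ (1 - t) + t * r := by
    have := mul_nonneg ht0 hr.le
    linarith
  rw [hv, hc]
  apply Real.sqrt_le_iff.2
  refine ⟨mul_nonneg hc0 (Real.sqrt_nonneg _), ?_⟩
  rw [mul_pow, Real.sq_sqrt (hnn x)]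
  simp only [mulVec_add, mulVec_smul, add_dotProduct, dotProduct_add, smul_dotProduct,
      dotProduct_smul, smul_eq_mul, hsymm]
  have h1 := mul_le_mul_of_nonneg_left hyx (mul_nonneg ht0 ht0)
  have h2 := mul_le_mul_of_nonneg_left hcs (mul_nonneg ht0 (sub_nonneg.2 ht1))
  nlinarith
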